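/- Distributional boundary value of the Fourier–Laplace transform: with C, C′, δ, k, γ, g as in the Fourier–Laplace setting (g bounded continuous, supp g ⊆ C*), let ψ ∈ 𝔥(T(ℝⁿ)), φ(ξ) = (2π)^{−n} ∫ ψ(x) e^{i⟨ξ,x⟩} dx, and G_ψ(y) = (−1)^{|γ|} ∫_{ℝⁿ} e^{k|ξ|₁} g(ξ) D^γ_ξ [ e^{−⟨ξ,y⟩} φ(ξ) ] dξ. Then lim_{y→0, y∈C′} G_ψ(y) = (−1)^{|γ|} ∫_{ℝⁿ} e^{k|ξ|₁} g(ξ) D^γ φ(ξ) dξ; that is, the Fourier–Laplace transform f(z) = (2π)^{−n}(−iz)^γ ∫ e^{k|ξ|₁} g(ξ) e^{i⟨ξ,z⟩} dξ converges, as y = Im z → 0 along C′ and in the sense of the pairings G_ψ against every ψ ∈ 𝔥(T(ℝⁿ)), to the tempered ultrahyperfunction ℱ^{−1}[V], V = D^γ[e^{k|ξ|₁}g(ξ)]. -/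

import Mathlib

open MeasureTheory Complex Filter Topology

noncomputable section

/-- Partial derivative in the `i`-th coordinate direction. -/
def pd {n : ℕ} (i : Fin n) (f : (Fin n → ℝ) → ℂ) : (Fin n → ℝ) → ℂ :=
  fun x => fderiv ℝ f x (Pi.single i 1)

/-- Multi-index derivative `D^α`. -/
def Dm {n : ℕ} (α : Fin n → ℕ) (f : (Fin n → ℝ) → ℂ) : (Fin n → ℝ) → ℂ :=
  (List.finRange n).foldr (fun i g => (pd i)^[α i] g) f

/-- Order `|α|` of a multi-index. -/
def mOrd {n : ℕ} (α : Fin n → ℕ) : ℕ := ∑ i, α i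

/-- Supporting function `h_K(ξ) = sup_{x ∈ K} ⟨ξ,x⟩` of a set `K`. -/
def hSupp {n : ℕ} (K : Set (Fin n → ℝ)) (ξ : Fin n → ℝ) : ℝ :=
  sSup ((fun x => ∑ i, ξ i * x i) '' K)

/-- The ℓ¹ norm `|ξ|₁ = ∑ i |ξ i|`. -/
def n1 {n : ℕ} (ξ : Fin n → ℝ) : ℝ := ∑ i, |ξ i|

/-- The vector of imaginary parts of `z ∈ ℂⁿ`. -/
def imv {n : ℕ} (z : Fin n → ℂ) : Fin n → ℝ := fun i => (z i).im

/-- Euclidean norm `|z|` on `ℂⁿ`. -/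
def cnorm {n : ℕ} (z : Fin n → ℂ) : ℝ := Real.sqrt (∑ i, ‖z i‖ ^ 2)

/-- Euclidean norm on `ℝⁿ`. -/
def en {n : ℕ} (y : Fin n → ℝ) : ℝ := Real.sqrt (∑ i, y i ^ 2)

/-- `C` is a cone with vertex at the origin: `ℝ₊ · C ⊆ C`. -/
def IsCone {n : ℕ} (C : Set (Fin n → ℝ)) : Prop :=
  ∀ t : ℝ, 0 < t → ∀ x ∈ C, t • x ∈ C

/-- The dual cone `C* = {ξ : ⟨ξ,y⟩ ≥ 0 for all y ∈ C}`. -/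
def dualCone {n : ℕ} (C : Set (Fin n → ℝ)) : Set (Fin n → ℝ) :=
  {ξ | ∀ y ∈ C, 0 ≤ ∑ i, ξ i * y i}

/-- `C′ ⋐ C`: the cone `C′` is compact in the cone `C`, i.e. the projection
`(closure C′) ∩ S^{n−1}` is contained in `C ∩ S^{n−1}`. -/
def CmpSub {n : ℕ} (C' C : Set (Fin n → ℝ)) : Prop :=
  IsCone C' ∧ closure C' ∩ {y | en y = 1} ⊆ C ∩ {y | en y = 1}

/-- Membership in `𝔥(T(ℝⁿ))`: entire and rapidly decreasing in every horizontal strip. -/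
def memFrakRn {n : ℕ} (ψ : (Fin n → ℂ) → ℂ) : Prop :=
  Differentiable ℂ ψ ∧ ∀ m : ℝ, 0 < m → ∀ N : ℕ, ∃ M : ℝ,
    ∀ z : Fin n → ℂ, (∀ i, |(z i).im| ≤ m) → (1 + cnorm z) ^ N * ‖ψ z‖ ≤ M


/-- The integrable weight `(1 + ‖x‖)^{-(n+1)}` on `ℝⁿ`. -/
def decayWeight {n : ℕ} (x : Fin n → ℝ) : ℝ := ((1 + ‖x‖) ^ (n + 1))⁻¹

lemma decayWeight_nonneg {n : ℕ} (x : Fin n → ℝ) : 0 ≤ decayWeight x := by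
  unfold decayWeight; positivity

lemma integrable_decayWeight {n : ℕ} : Integrable (decayWeight (n := n)) := by
  have h := integrable_one_add_norm (E := Fin n → ℝ) (μ := volume) (r := ((n + 1 : ℕ) : ℝ))
    (by simp)
  refine h.congr (Eventually.of_forall fun x => ?_)
  have : (0 : ℝ) ≤ 1 + ‖x‖ := by positivity
  simp only [decayWeight]
  rw [Real.rpow_neg this, Real.rpow_natCast]

/-- Peetre's inequality for `decayWeight`. -/
lemma decayWeight_add_le {n : ℕ} {R : ℝ} (x v : Fin n → ℝ) (hv : ‖v‖ ≤ R) :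
    decayWeight (x + v) ≤ (1 + R) ^ (n + 1) * decayWeight x := by
  have hR : 0 ≤ R := (norm_nonneg v).trans hv
  unfold decayWeight
  rw [← div_eq_mul_inv, inv_eq_one_div, div_le_div_iff₀ (by positivity) (by positivity), one_mul,
    ← mul_pow]
  refine pow_le_pow_left₀ (by positivity) ?_ _
  have h1 : ‖x‖ ≤ ‖x + v‖ + ‖v‖ := by
    simpa using norm_sub_le (x + v) v
  nlinarith [norm_nonneg (x + v), norm_nonneg v]

/-- The integral over a horizontal translate `ℝⁿ + iη` of an entire function which decays
in every horizontal strip does not depend on `η`. -/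
lemma integral_add_I_mul_eq {n : ℕ} {h : (Fin n → ℂ) → ℂ} (hd : Differentiable ℂ h)
    (hb : ∀ m : ℝ, ∃ K : ℝ, ∀ z : Fin n → ℂ, (∀ i, |(z i).im| ≤ m) →
      ‖h z‖ ≤ K * decayWeight (fun i => (z i).re)) (η : Fin n → ℝ) :
    ∫ x : Fin n → ℝ, h (fun i => x i + I * η i) = ∫ x : Fin n → ℝ, h (fun i => (x i : ℂ)) := by
  set f : ℂ → (Fin n → ℝ) → ℂ := fun t x => h (fun i => x i + t * η i) with hf
  have hfd : ∀ x, Differentiable ℂ (fun t => f t x) := fun x =>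
    hd.comp (by fun_prop)
  have hfc : Continuous (fun q : (Fin n → ℝ) × ℂ => f q.2 q.1) :=
    hd.continuous.comp (by fun_prop)
  have hbound : ∀ T : ℝ, ∃ K : ℝ, ∀ t : ℂ, ‖t‖ ≤ T → ∀ x, ‖f t x‖ ≤ K * decayWeight x := by
    intro T
    obtain ⟨K, hK⟩ := hb (T * ‖η‖)
    refine ⟨|K| * (1 + T * ‖η‖) ^ (n + 1), fun t ht x => ?_⟩
    have hT : 0 ≤ T := (norm_nonneg t).trans ht
    have h1 := hK (fun i => x i + t * η i) (fun i => by
      have : ((x i : ℂ) + t * η i).im = t.im * η i := by simp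
      rw [this, abs_mul]
      exact mul_le_mul ((abs_im_le_norm t).trans ht) (norm_le_pi_norm η i) (abs_nonneg _) hT)
    have h2 : (fun i => ((x i : ℂ) + t * η i).re) = x + t.re • η := by
      ext i; simp
    rw [h2] at h1
    have h3 : ‖t.re • η‖ ≤ T * ‖η‖ := by
      rw [norm_smul]
      exact mul_le_mul_of_nonneg_right ((abs_re_le_norm t).trans ht) (norm_nonneg _)
    calc ‖f t x‖ ≤ K * decayWeight (x + t.re • η) := h1
      _ ≤ |K| * decayWeight (x + t.re • η) :=
        mul_le_mul_of_nonneg_right (le_abs_self K) (decayWeight_nonneg _)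
      _ ≤ |K| * ((1 + T * ‖η‖) ^ (n + 1) * decayWeight x) :=
        mul_le_mul_of_nonneg_left (decayWeight_add_le x _ h3) (abs_nonneg _)
      _ = _ := by ring
  have hmeas : ∀ t, AEStronglyMeasurable (f t) volume := fun t =>
    (hfc.comp (by fun_prop : Continuous fun x : Fin n → ℝ => (x, t))).aestronglyMeasurable
  have hA : Differentiable ℂ (fun t => ∫ x, f t x) := by
    intro t₀
    obtain ⟨K, hK⟩ := hbound (‖t₀‖ + 2)
    have hderiv := hasDerivAt_integral_of_dominated_loc_of_deriv_le (μ := volume) (𝕜 := ℂ)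
      (F := f) (F' := fun t x => deriv (fun s => f s x) t) (x₀ := t₀) (s := Metric.ball t₀ 1)
      (bound := fun x => K * decayWeight x)
      (Metric.ball_mem_nhds _ one_pos) (Eventually.of_forall hmeas)
      ((integrable_decayWeight.const_mul K).mono' (hmeas t₀)
        (Eventually.of_forall (hK t₀ (by linarith))))
      ((measurable_deriv_with_param (f := fun x t => f t x) hfc).comp
        (measurable_id.prodMk measurable_const)).aestronglyMeasurable
      (Eventually.of_forall fun x t ht => ?_) (integrable_decayWeight.const_mul K)
      (Eventually.of_forall fun x t _ => (hfd x t).hasDerivAt)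
    · exact hderiv.2.differentiableAt
    · have := norm_deriv_le_of_forall_mem_sphere_norm_le (f := fun s => f s x) (c := t) one_pos
        (hfd x).diffContOnCl (C := K * decayWeight x) (fun s hs => hK s ?_ x)
      · simpa using this
      · have h1 : ‖s - t‖ = 1 := by simpa using hs
        have h2 : ‖t - t₀‖ < 1 := by simpa [dist_eq_norm] using ht
        have h3 : s = t₀ + (t - t₀) + (s - t) := by ring
        calc ‖s‖ = ‖t₀ + (t - t₀) + (s - t)‖ := by rw [← h3]
          _ ≤ ‖t₀‖ + ‖t - t₀‖ + ‖s - t‖ := norm_add₃_le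
          _ ≤ _ := by linarith
  have hreal : ∀ s : ℝ, ∫ x, f s x = ∫ x, f 0 x := by
    intro s
    rw [← integral_add_right_eq_self (f 0) (s • η)]
    refine integral_congr_ae (Eventually.of_forall fun x => ?_)
    simp [hf]
  have hcl : (0 : ℂ) ∈ closure ({t : ℂ | (∫ x, f t x) = ∫ x, f 0 x} \ {0}) := by
    have ht : Tendsto (fun s : ℝ => (s : ℂ)) (𝓝[≠] 0) (𝓝 0) :=
      (continuous_ofReal.tendsto' 0 0 (by simp)).mono_left nhdsWithin_le_nhds
    refine mem_closure_of_tendsto ht ?_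
    filter_upwards [self_mem_nhdsWithin] with s hs
    exact ⟨hreal s, by simpa using hs⟩
  have hfreq : ∃ᶠ t in 𝓝[≠] (0 : ℂ), (∫ x, f t x) = ∫ x, f 0 x := by
    rw [frequently_iff]
    intro U hU
    obtain ⟨V, hV, hVU⟩ := mem_nhdsWithin_iff_exists_mem_nhds_inter.1 hU
    obtain ⟨t, htV, ht, ht0⟩ := mem_closure_iff_nhds.1 hcl V hV
    exact ⟨t, hVU ⟨htV, ht0⟩, ht⟩
  have hconst := AnalyticOnNhd.eq_of_frequently_eq
    (f := fun t => ∫ x, f t x) (g := fun _ => ∫ x, f 0 x) (z₀ := 0)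
    (fun t _ => hA.analyticAt t) (fun t _ => analyticAt_const) hfreq
  simpa [hf] using congrFun hconst I

/-- Continuous functions on `ℝⁿ` decreasing faster than every power. -/
def RapidDecay {n : ℕ} (p : (Fin n → ℝ) → ℂ) : Prop :=
  Continuous p ∧ ∀ N : ℕ, ∃ M : ℝ, ∀ x, (1 + ‖x‖) ^ N * ‖p x‖ ≤ M

lemma RapidDecay.norm_le {n : ℕ} {p : (Fin n → ℝ) → ℂ} (hp : RapidDecay p) :
    ∃ M : ℝ, ∀ x, ‖p x‖ ≤ M * decayWeight x := by
  obtain ⟨M, hM⟩ := hp.2 (n + 1)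
  refine ⟨M, fun x => ?_⟩
  rw [decayWeight, ← div_eq_mul_inv, le_div_iff₀ (by positivity), mul_comm]
  exact hM x

/-- The coordinate `i (x_j + i y_j)` of `i z`. -/
def rotCoord {n : ℕ} (y x : Fin n → ℝ) (j : Fin n) : ℂ := I * (x j + I * y j)

lemma continuous_rotCoord {n : ℕ} (y : Fin n → ℝ) (j : Fin n) :
    Continuous fun x => rotCoord y x j := by
  unfold rotCoord; fun_prop

lemma norm_rotCoord_le {n : ℕ} (y x : Fin n → ℝ) (j : Fin n) :
    ‖rotCoord y x j‖ ≤ ‖x‖ + ‖y‖ := by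
  have h := norm_add_le (x j : ℂ) (I * y j)
  simp only [norm_mul, norm_I, one_mul, norm_real] at h
  rw [rotCoord, norm_mul, norm_I, one_mul]
  linarith [norm_le_pi_norm x j, norm_le_pi_norm y j]

lemma RapidDecay.rotCoord_mul {n : ℕ} {p : (Fin n → ℝ) → ℂ} (hp : RapidDecay p)
    (y : Fin n → ℝ) (j : Fin n) : RapidDecay fun x => rotCoord y x j * p x := by
  refine ⟨(continuous_rotCoord y j).mul hp.1, fun N => ?_⟩
  obtain ⟨M, hM⟩ := hp.2 (N + 1)
  refine ⟨(1 + ‖y‖) * M, fun x => ?_⟩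
  have h1 : ‖rotCoord y x j‖ ≤ (1 + ‖y‖) * (1 + ‖x‖) := by
    nlinarith [norm_rotCoord_le y x j, norm_nonneg x, norm_nonneg y]
  calc (1 + ‖x‖) ^ N * ‖rotCoord y x j * p x‖
      = (1 + ‖x‖) ^ N * (‖rotCoord y x j‖ * ‖p x‖) := by rw [norm_mul]
    _ ≤ (1 + ‖x‖) ^ N * ((1 + ‖y‖) * (1 + ‖x‖) * ‖p x‖) := by gcongr
    _ = (1 + ‖y‖) * ((1 + ‖x‖) ^ (N + 1) * ‖p x‖) := by ring
    _ ≤ (1 + ‖y‖) * M := by gcongr; exact hM x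

/-- The exponential `exp (i ⟨ξ, x + i y⟩)`. -/
def expPair {n : ℕ} (y ξ x : Fin n → ℝ) : ℂ := cexp (∑ j, (ξ j : ℂ) * rotCoord y x j)

lemma norm_expPair {n : ℕ} (y ξ x : Fin n → ℝ) :
    ‖expPair y ξ x‖ = Real.exp (-∑ j, ξ j * y j) := by
  rw [expPair, norm_exp, ← Finset.sum_neg_distrib]
  simp [rotCoord]

lemma continuous_expPair {n : ℕ} (y ξ : Fin n → ℝ) : Continuous (expPair y ξ) := by
  have := fun j => continuous_rotCoord (n := n) y j
  unfold expPair; fun_prop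

/-- The Fourier–Laplace integral `ξ ↦ ∫ p(x) exp (i ⟨ξ, x + i y⟩) dx`. -/
def laplaceInt {n : ℕ} (y : Fin n → ℝ) (p : (Fin n → ℝ) → ℂ) (ξ : Fin n → ℝ) : ℂ :=
  ∫ x, p x * expPair y ξ x

lemma neg_sum_mul_le {n : ℕ} (ξ y : Fin n → ℝ) : -∑ j, ξ j * y j ≤ n * (‖ξ‖ * ‖y‖) := by
  rw [← Finset.sum_neg_distrib]
  calc ∑ j, -(ξ j * y j) ≤ ∑ _j : Fin n, ‖ξ‖ * ‖y‖ := by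
        refine Finset.sum_le_sum fun j _ => (neg_le_abs _).trans ?_
        rw [abs_mul]
        exact mul_le_mul (norm_le_pi_norm ξ j) (norm_le_pi_norm y j) (abs_nonneg _) (norm_nonneg _)
    _ = _ := by simp

lemma RapidDecay.integrable_mul_expPair {n : ℕ} {p : (Fin n → ℝ) → ℂ} (hp : RapidDecay p)
    (y ξ : Fin n → ℝ) : Integrable fun x => p x * expPair y ξ x := by
  obtain ⟨M, hM⟩ := hp.norm_le
  refine ((integrable_decayWeight.const_mul M).mul_const (Real.exp (-∑ j, ξ j * y j))).mono'
    (hp.1.mul (continuous_expPair y ξ)).aestronglyMeasurable (Eventually.of_forall fun x => ?_)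
  rw [norm_mul, norm_expPair]
  exact mul_le_mul_of_nonneg_right (hM x) (Real.exp_pos _).le

/-- The differential of `ξ ↦ ∑ j, ξ j * rotCoord y x j`. -/
def rotForm {n : ℕ} (y x : Fin n → ℝ) : (Fin n → ℝ) →L[ℝ] ℂ :=
  ∑ j, (ContinuousLinearMap.proj (R := ℝ) (φ := fun _ : Fin n => ℝ) j).smulRight (rotCoord y x j)

lemma rotForm_apply {n : ℕ} (y x v : Fin n → ℝ) :
    rotForm y x v = ∑ j, (v j : ℂ) * rotCoord y x j := by
  simp [rotForm]

lemma hasFDerivAt_expPair {n : ℕ} (y x ξ : Fin n → ℝ) :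
    HasFDerivAt (fun ξ => expPair y ξ x) (expPair y ξ x • rotForm y x) ξ := by
  have h : (fun ξ => expPair y ξ x) = fun ξ => cexp (rotForm y x ξ) := by
    ext ξ; rw [rotForm_apply, expPair]
  have h2 : expPair y ξ x = cexp (rotForm y x ξ) := congrFun h ξ
  rw [h, h2]
  exact (rotForm y x).hasFDerivAt.cexp

lemma norm_rotForm_le {n : ℕ} (y x : Fin n → ℝ) : ‖rotForm y x‖ ≤ ∑ j, ‖rotCoord y x j‖ := by
  refine ContinuousLinearMap.opNorm_le_bound _ (by positivity) fun v => ?_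
  rw [rotForm_apply, Finset.sum_mul]
  refine (norm_sum_le _ _).trans (Finset.sum_le_sum fun j _ => ?_)
  rw [norm_mul, norm_real, mul_comm]
  exact mul_le_mul_of_nonneg_left (norm_le_pi_norm v j) (norm_nonneg _)

lemma continuous_rotForm {n : ℕ} (y : Fin n → ℝ) : Continuous (rotForm y) := by
  unfold rotForm
  refine continuous_finsetSum _ fun j _ => ?_
  exact (ContinuousLinearMap.smulRightL ℝ (Fin n → ℝ) ℂ
    (ContinuousLinearMap.proj (R := ℝ) (φ := fun _ : Fin n => ℝ) j)).continuous.comp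
    (continuous_rotCoord y j)

lemma RapidDecay.hasFDerivAt_laplaceInt {n : ℕ} {p : (Fin n → ℝ) → ℂ} (hp : RapidDecay p)
    (y ξ₀ : Fin n → ℝ) :
    HasFDerivAt (laplaceInt y p) (∫ x, (p x * expPair y ξ₀ x) • rotForm y x) ξ₀ := by
  have hj := fun j => (hp.rotCoord_mul y j).norm_le
  choose M hM using hj
  have hball : ∀ ξ ∈ Metric.ball ξ₀ 1, ∀ x, ‖expPair y ξ x‖
      ≤ Real.exp (n * ((‖ξ₀‖ + 1) * ‖y‖)) := by
    intro ξ hξ x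
    rw [norm_expPair]
    refine Real.exp_le_exp.2 ((neg_sum_mul_le ξ y).trans ?_)
    have : ‖ξ‖ ≤ ‖ξ₀‖ + 1 := by
      have h1 : ‖ξ - ξ₀‖ < 1 := by simpa [dist_eq_norm] using hξ
      linarith [norm_le_norm_add_norm_sub' ξ ξ₀]
    gcongr
  refine hasFDerivAt_integral_of_dominated_of_fderiv_le (s := Metric.ball ξ₀ 1)
    (F := fun ξ x => p x * expPair y ξ x) (F' := fun ξ x => (p x * expPair y ξ x) • rotForm y x)
    (bound := fun x => Real.exp (n * ((‖ξ₀‖ + 1) * ‖y‖)) * ((∑ j, M j) * decayWeight x))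
    (Metric.ball_mem_nhds _ one_pos)
    (Eventually.of_forall fun ξ => (hp.integrable_mul_expPair y ξ).aestronglyMeasurable)
    (hp.integrable_mul_expPair y ξ₀)
    ((hp.1.mul (continuous_expPair y ξ₀)).smul (continuous_rotForm y)).aestronglyMeasurable
    (Eventually.of_forall fun x ξ hξ => ?_)
    ((integrable_decayWeight.const_mul _).const_mul _)
    (Eventually.of_forall fun x ξ _ => ?_)
  · rw [norm_smul, norm_mul]
    have h1 : ‖p x‖ * ‖rotForm y x‖ ≤ (∑ j, M j) * decayWeight x := by
      calc ‖p x‖ * ‖rotForm y x‖ ≤ ‖p x‖ * ∑ j, ‖rotCoord y x j‖ := by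
            gcongr; exact norm_rotForm_le y x
        _ = ∑ j, ‖rotCoord y x j * p x‖ := by
            rw [Finset.mul_sum]; simp [mul_comm]
        _ ≤ ∑ j, M j * decayWeight x := Finset.sum_le_sum fun j _ => hM j x
        _ = _ := by rw [Finset.sum_mul]
    calc ‖p x‖ * ‖expPair y ξ x‖ * ‖rotForm y x‖
        = ‖expPair y ξ x‖ * (‖p x‖ * ‖rotForm y x‖) := by ring
      _ ≤ _ := mul_le_mul (hball ξ hξ x) h1 (by positivity) (by positivity)
  · have := (hasFDerivAt_expPair y x ξ).const_mul (p x)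
    rwa [smul_smul] at this

lemma RapidDecay.continuous_laplaceInt {n : ℕ} {p : (Fin n → ℝ) → ℂ} (hp : RapidDecay p)
    (y : Fin n → ℝ) : Continuous (laplaceInt y p) :=
  continuous_iff_continuousAt.2 fun ξ => (hp.hasFDerivAt_laplaceInt y ξ).continuousAt

lemma RapidDecay.pd_laplaceInt {n : ℕ} {p : (Fin n → ℝ) → ℂ} (hp : RapidDecay p) (c : ℂ)
    (y : Fin n → ℝ) (i : Fin n) :
    pd i (fun ξ => c * laplaceInt y p ξ) =
      fun ξ => c * laplaceInt y (fun x => rotCoord y x i * p x) ξ := by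
  ext ξ
  have hint : Integrable fun x => (p x * expPair y ξ x) • rotForm y x := by
    have hj := fun j => (hp.rotCoord_mul y j).integrable_mul_expPair y ξ
    refine (integrable_finsetSum Finset.univ fun j _ => (hj j).norm).mono'
      ((hp.1.mul (continuous_expPair y ξ)).smul (continuous_rotForm y)).aestronglyMeasurable
      (Eventually.of_forall fun x => ?_)
    rw [norm_smul]
    calc ‖p x * expPair y ξ x‖ * ‖rotForm y x‖
        ≤ ‖p x * expPair y ξ x‖ * ∑ j, ‖rotCoord y x j‖ := by
          gcongr; exact norm_rotForm_le y x
      _ = _ := by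
          rw [Finset.mul_sum]
          refine Finset.sum_congr rfl fun j _ => ?_
          simp only [norm_mul]; ring
  rw [pd, ((hp.hasFDerivAt_laplaceInt y ξ).const_mul c).fderiv, _root_.smul_apply,
    ContinuousLinearMap.integral_apply hint, smul_eq_mul, laplaceInt]
  congr 1
  refine integral_congr_ae (Eventually.of_forall fun x => ?_)
  have : rotForm y x (Pi.single i 1) = rotCoord y x i := by
    rw [rotForm_apply, Finset.sum_eq_single i] <;> simp +contextual
  simp only [_root_.smul_apply, this, smul_eq_mul]
  ring

lemma RapidDecay.rotCoord_pow_mul {n : ℕ} {p : (Fin n → ℝ) → ℂ} (hp : RapidDecay p)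
    (y : Fin n → ℝ) (j : Fin n) (k : ℕ) : RapidDecay fun x => rotCoord y x j ^ k * p x := by
  induction k with
  | zero => simpa using hp
  | succ k ih => simpa only [pow_succ', mul_assoc] using ih.rotCoord_mul y j

lemma RapidDecay.iterate_pd_laplaceInt {n : ℕ} {p : (Fin n → ℝ) → ℂ} (hp : RapidDecay p) (c : ℂ)
    (y : Fin n → ℝ) (i : Fin n) (k : ℕ) :
    (pd i)^[k] (fun ξ => c * laplaceInt y p ξ) =
      fun ξ => c * laplaceInt y (fun x => rotCoord y x i ^ k * p x) ξ := by
  induction k with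
  | zero => simp
  | succ k ih =>
    rw [Function.iterate_succ_apply', ih, (hp.rotCoord_pow_mul y i k).pd_laplaceInt]
    simp only [pow_succ', mul_assoc]

lemma RapidDecay.foldr_pd_laplaceInt {n : ℕ} {p : (Fin n → ℝ) → ℂ} (hp : RapidDecay p) (c : ℂ)
    (y : Fin n → ℝ) (γ : Fin n → ℕ) (l : List (Fin n)) :
    RapidDecay (fun x => (l.map fun i => rotCoord y x i ^ γ i).prod * p x) ∧
    l.foldr (fun i g => (pd i)^[γ i] g) (fun ξ => c * laplaceInt y p ξ) =
      fun ξ => c * laplaceInt y (fun x => (l.map fun i => rotCoord y x i ^ γ i).prod * p x) ξ := by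
  induction l with
  | nil => simpa using hp
  | cons i l ih =>
    rw [List.foldr_cons, ih.2, ih.1.iterate_pd_laplaceInt]
    simp only [List.map_cons, List.prod_cons, mul_assoc]
    exact ⟨ih.1.rotCoord_pow_mul y i (γ i), trivial⟩

lemma RapidDecay.prod_rotCoord_mul {n : ℕ} {p : (Fin n → ℝ) → ℂ} (hp : RapidDecay p)
    (y : Fin n → ℝ) (γ : Fin n → ℕ) : RapidDecay fun x => (∏ i, rotCoord y x i ^ γ i) * p x := by
  simpa only [← List.prod_ofFn, List.ofFn_eq_map] using
    (hp.foldr_pd_laplaceInt 0 y γ (List.finRange n)).1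

lemma RapidDecay.Dm_laplaceInt {n : ℕ} {p : (Fin n → ℝ) → ℂ} (hp : RapidDecay p) (c : ℂ)
    (y : Fin n → ℝ) (γ : Fin n → ℕ) :
    Dm γ (fun ξ => c * laplaceInt y p ξ) =
      fun ξ => c * laplaceInt y (fun x => (∏ i, rotCoord y x i ^ γ i) * p x) ξ := by
  simpa only [Dm, ← List.prod_ofFn, List.ofFn_eq_map] using
    (hp.foldr_pd_laplaceInt c y γ (List.finRange n)).2

lemma norm_re_le_cnorm {n : ℕ} (z : Fin n → ℂ) : ‖fun i => (z i).re‖ ≤ cnorm z := by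
  refine (pi_norm_le_iff_of_nonneg (Real.sqrt_nonneg _)).2 fun i => ?_
  refine (abs_re_le_norm (z i)).trans (Real.le_sqrt_of_sq_le ?_)
  exact Finset.single_le_sum (f := fun i => ‖z i‖ ^ 2) (fun _ _ => by positivity)
    (Finset.mem_univ i)

lemma norm_apply_le_cnorm {n : ℕ} (z : Fin n → ℂ) (i : Fin n) : ‖z i‖ ≤ cnorm z :=
  Real.le_sqrt_of_sq_le (Finset.single_le_sum (f := fun i => ‖z i‖ ^ 2)
    (fun _ _ => by positivity) (Finset.mem_univ i))

lemma memFrakRn.rapidDecay {n : ℕ} {ψ : (Fin n → ℂ) → ℂ} (hψ : memFrakRn ψ) :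
    RapidDecay fun x : Fin n → ℝ => ψ (fun i => (x i : ℂ)) := by
  refine ⟨hψ.1.continuous.comp (by fun_prop), fun N => ?_⟩
  obtain ⟨M, hM⟩ := hψ.2 1 one_pos N
  refine ⟨M, fun x => le_trans ?_ (hM (fun i => (x i : ℂ)) (by simp))⟩
  have h := norm_re_le_cnorm (fun i => (x i : ℂ))
  simp only [ofReal_re] at h
  gcongr

lemma memFrakRn.norm_prod_mul_le {n : ℕ} {ψ : (Fin n → ℂ) → ℂ} (hψ : memFrakRn ψ)
    (γ : Fin n → ℕ) (m R : ℝ) :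
    ∃ K : ℝ, ∀ y : Fin n → ℝ, ‖y‖ ≤ R → ∀ z : Fin n → ℂ, (∀ i, |(z i).im| ≤ m) →
      ‖(∏ i, (I * (z i + I * y i)) ^ γ i) * ψ z‖ ≤ K * decayWeight (fun i => (z i).re) := by
  obtain ⟨M, hM⟩ := hψ.2 (|m| + 1) (by positivity) (mOrd γ + (n + 1))
  refine ⟨(1 + |R|) ^ mOrd γ * M, fun y hy z hz => ?_⟩
  have hc : 0 ≤ cnorm z := Real.sqrt_nonneg _
  have h1 : ‖∏ i, (I * (z i + I * y i)) ^ γ i‖ ≤ ((1 + |R|) * (1 + cnorm z)) ^ mOrd γ := by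
    rw [norm_prod, mOrd, ← Finset.prod_pow_eq_pow_sum]
    refine Finset.prod_le_prod (fun _ _ => norm_nonneg _) fun i _ => ?_
    rw [norm_pow]
    refine pow_le_pow_left₀ (norm_nonneg _) ?_ _
    have h := norm_add_le (z i) (I * y i)
    simp only [norm_mul, norm_I, one_mul, norm_real] at h ⊢
    nlinarith [norm_apply_le_cnorm z i, norm_le_pi_norm y i, le_abs_self R, abs_nonneg R]
  rw [norm_mul, decayWeight, ← div_eq_mul_inv, le_div_iff₀ (by positivity)]
  have h2 := hM z fun i => (hz i).trans (by linarith [le_abs_self m])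
  calc ‖∏ i, (I * (z i + I * y i)) ^ γ i‖ * ‖ψ z‖ * (1 + ‖fun i => (z i).re‖) ^ (n + 1)
      ≤ ((1 + |R|) * (1 + cnorm z)) ^ mOrd γ * ‖ψ z‖ * (1 + cnorm z) ^ (n + 1) := by
        gcongr
        exact norm_re_le_cnorm z
    _ = (1 + |R|) ^ mOrd γ * ((1 + cnorm z) ^ (mOrd γ + (n + 1)) * ‖ψ z‖) := by
        rw [mul_pow, pow_add]; ring
    _ ≤ _ := by gcongr

lemma norm_cexp_pair {n : ℕ} (ξ y : Fin n → ℝ) (z : Fin n → ℂ) :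
    ‖cexp (∑ j, (ξ j : ℂ) * (I * (z j + I * y j)))‖ =
      Real.exp (-∑ j, ξ j * y j) * Real.exp (-∑ j, ξ j * (z j).im) := by
  rw [norm_exp, ← Real.exp_add, ← neg_add, ← Finset.sum_add_distrib, ← Finset.sum_neg_distrib]
  congr 1
  simp only [re_sum]
  refine Finset.sum_congr rfl fun j _ => ?_
  simp
  ring

lemma memFrakRn.norm_laplaceInt_le {n : ℕ} {ψ : (Fin n → ℂ) → ℂ} (hψ : memFrakRn ψ)
    (γ : Fin n → ℕ) {m : ℝ} (hm : 0 ≤ m) (R : ℝ) :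
    ∃ K : ℝ, ∀ y : Fin n → ℝ, ‖y‖ ≤ R → ∀ ξ,
      ‖laplaceInt y (fun x => (∏ i, rotCoord y x i ^ γ i) * ψ (fun i => (x i : ℂ))) ξ‖ ≤
        Real.exp (-∑ j, ξ j * y j) * (K * Real.exp (-(m * n1 ξ))) := by
  obtain ⟨K, hK⟩ := hψ.norm_prod_mul_le γ m R
  refine ⟨K * ∫ x, decayWeight (n := n) x, fun y hy ξ => ?_⟩
  set h : (Fin n → ℂ) → ℂ := fun z => (∏ i, (I * (z i + I * y i)) ^ γ i) * ψ z *
    cexp (∑ j, (ξ j : ℂ) * (I * (z j + I * y j))) with hh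
  have hd : Differentiable ℂ h := by
    have := hψ.1
    fun_prop
  have hb : ∀ m : ℝ, ∃ K : ℝ, ∀ z : Fin n → ℂ, (∀ i, |(z i).im| ≤ m) →
      ‖h z‖ ≤ K * decayWeight (fun i => (z i).re) := by
    intro m'
    obtain ⟨K', hK'⟩ := hψ.norm_prod_mul_le γ m' R
    refine ⟨Real.exp (-∑ j, ξ j * y j) * Real.exp (m' * n1 ξ) * K', fun z hz => ?_⟩
    have he : -∑ j, ξ j * (z j).im ≤ m' * n1 ξ := by
      rw [n1, Finset.mul_sum, ← Finset.sum_neg_distrib]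
      refine Finset.sum_le_sum fun j _ => (neg_le_abs _).trans ?_
      rw [abs_mul, mul_comm]
      exact mul_le_mul_of_nonneg_right (hz j) (abs_nonneg _)
    calc ‖h z‖ = ‖(∏ i, (I * (z i + I * y i)) ^ γ i) * ψ z‖ *
          (Real.exp (-∑ j, ξ j * y j) * Real.exp (-∑ j, ξ j * (z j).im)) := by
          rw [hh, ← norm_cexp_pair, norm_mul]
      _ ≤ (K' * decayWeight (fun i => (z i).re)) *
          (Real.exp (-∑ j, ξ j * y j) * Real.exp (m' * n1 ξ)) :=
          mul_le_mul (hK' y hy z hz) (by gcongr) (by positivity)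
            ((norm_nonneg _).trans (hK' y hy z hz))
      _ = _ := by ring
  set η : Fin n → ℝ := fun j => if 0 ≤ ξ j then m else -m with hη
  have hη1 : ∀ j, |η j| ≤ m := fun j => by
    simp only [hη]; split_ifs <;> simp [abs_of_nonneg hm]
  have hη2 : ∑ j, ξ j * η j = m * n1 ξ := by
    rw [n1, Finset.mul_sum]
    refine Finset.sum_congr rfl fun j _ => ?_
    simp only [hη]
    split_ifs with hj
    · rw [abs_of_nonneg hj, mul_comm]
    · rw [abs_of_neg (not_le.1 hj)]; ring
  have hL : laplaceInt y (fun x => (∏ i, rotCoord y x i ^ γ i) * ψ (fun i => (x i : ℂ))) ξ =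
      ∫ x : Fin n → ℝ, h (fun i => x i + I * η i) := (integral_add_I_mul_eq hd hb η).symm
  rw [hL]
  calc ‖∫ x : Fin n → ℝ, h (fun i => x i + I * η i)‖
      ≤ ∫ x : Fin n → ℝ, Real.exp (-∑ j, ξ j * y j) * Real.exp (-(m * n1 ξ)) * K *
          decayWeight x := by
        refine norm_integral_le_of_norm_le (integrable_decayWeight.const_mul _)
          (Eventually.of_forall fun x => ?_)
        have h1 := hK y hy (fun i => x i + I * η i) (by simpa using hη1)
        simp only [add_re, ofReal_re, mul_re, I_re, zero_mul, I_im, ofReal_im, mul_zero, sub_zero,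
          add_zero] at h1
        simp only [hh]
        rw [norm_mul, norm_cexp_pair]
        simp only [add_im, ofReal_im, mul_im, I_re, zero_mul, I_im, one_mul, ofReal_re, zero_add,
          hη2]
        calc _ ≤ (K * decayWeight x) * (Real.exp (-∑ j, ξ j * y j) * Real.exp (-(m * n1 ξ))) :=
              mul_le_mul_of_nonneg_right h1 (by positivity)
          _ = _ := by ring
    _ = _ := by rw [integral_const_mul]; ring

lemma memFrakRn.tendsto_laplaceInt {n : ℕ} {ψ : (Fin n → ℂ) → ℂ} (hψ : memFrakRn ψ)
    (γ : Fin n → ℕ) (ξ : Fin n → ℝ) :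
    Tendsto (fun y => laplaceInt y
        (fun x => (∏ i, rotCoord y x i ^ γ i) * ψ (fun i => (x i : ℂ))) ξ) (𝓝 0)
      (𝓝 (laplaceInt 0 (fun x => (∏ i, rotCoord 0 x i ^ γ i) * ψ (fun i => (x i : ℂ))) ξ)) := by
  obtain ⟨K, hK⟩ := hψ.norm_prod_mul_le γ 0 1
  refine tendsto_integral_filter_of_dominated_convergence
    (fun x => K * decayWeight x * Real.exp (n * (‖ξ‖ * 1))) ?_ ?_
    ((integrable_decayWeight.const_mul _).mul_const _) ?_
  · exact Eventually.of_forall fun y =>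
      ((hψ.rapidDecay.prod_rotCoord_mul y γ).integrable_mul_expPair y ξ).aestronglyMeasurable
  · filter_upwards [Metric.closedBall_mem_nhds (0 : Fin n → ℝ) one_pos] with y hy
    have hy1 : ‖y‖ ≤ 1 := by simpa using hy
    refine Eventually.of_forall fun x => ?_
    have h1 := hK y hy1 (fun i => (x i : ℂ)) (by simp)
    simp only [ofReal_re] at h1
    rw [norm_mul, norm_expPair]
    refine mul_le_mul h1 (Real.exp_le_exp.2 ((neg_sum_mul_le ξ y).trans ?_)) (Real.exp_pos _).le
      ((norm_nonneg _).trans h1)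
    gcongr
  · refine Eventually.of_forall fun x => ?_
    have : Continuous fun y : Fin n → ℝ =>
        (∏ i, rotCoord y x i ^ γ i) * ψ (fun i => (x i : ℂ)) * expPair y ξ x := by
      unfold rotCoord expPair rotCoord; fun_prop
    exact this.tendsto 0

lemma integrable_exp_neg_n1 {n : ℕ} : Integrable fun ξ : Fin n → ℝ => Real.exp (-n1 ξ) := by
  have h1 : Integrable fun x : ℝ => Real.exp (-|x|) := by
    rw [← integrableOn_univ, ← Set.Iic_union_Ioi (a := (0 : ℝ))]
    refine IntegrableOn.union ((integrableOn_exp_Iic 0).congr_fun (fun x hx => ?_)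
      measurableSet_Iic) ((integrableOn_exp_neg_Ioi 0).congr_fun (fun x hx => ?_)
      measurableSet_Ioi)
    · simp [abs_of_nonpos (Set.mem_Iic.1 hx)]
    · simp [abs_of_pos (Set.mem_Ioi.1 hx)]
  have := Integrable.fintype_prod (ι := Fin n) (μ := fun _ => volume)
    (f := fun _ x => Real.exp (-|x|)) fun _ => h1
  refine this.congr (Eventually.of_forall fun ξ => ?_)
  simp only [n1]
  rw [← Real.exp_sum, Finset.sum_neg_distrib]

lemma continuous_n1 {n : ℕ} : Continuous (n1 (n := n)) := by
  unfold n1; fun_prop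

/-- Distributional boundary value of the Fourier–Laplace transform:
as `y → 0` in `C′`, the regularized pairings `G_ψ(y)` tend to the pairing of
`V = D^γ[e^{k|ξ|₁} g]` with `φ`, i.e. the boundary value of `f` is `ℱ^{−1}[V]`. -/
theorem stmt_13 {n : ℕ} (C C' : Set (Fin n → ℝ))
    (hCo : IsOpen C) (hCc : Convex ℝ C) (hCcone : IsCone C)
    (hsub : CmpSub C' C)
    (δ : ℝ) (hδ : 0 < δ)
    (hsep : ∀ ξ ∈ dualCone C, ∀ y ∈ C', δ * (en ξ * en y) ≤ ∑ i, ξ i * y i)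
    (k : ℝ) (hk : 0 ≤ k) (γ : Fin n → ℕ)
    (g : (Fin n → ℝ) → ℂ) (hgc : Continuous g) (hgb : ∃ M : ℝ, ∀ ξ, ‖g ξ‖ ≤ M)
    (hsupp : Function.support g ⊆ dualCone C)
    (ψ : (Fin n → ℂ) → ℂ) (hψ : memFrakRn ψ)
    (φ : (Fin n → ℝ) → ℂ)
    (hφ : φ = fun ξ => (((2 * Real.pi) ^ n : ℝ) : ℂ)⁻¹ *
      ∫ x : Fin n → ℝ,
        ψ (fun i => (x i : ℂ)) * Complex.exp (Complex.I * ∑ i, (ξ i : ℂ) * (x i : ℂ)))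
    (G : (Fin n → ℝ) → ℂ)
    (hG : G = fun y => (-1 : ℂ) ^ mOrd γ *
      ∫ ξ : Fin n → ℝ, (Real.exp (k * n1 ξ) : ℂ) * g ξ *
        Dm γ (fun ξ' => (Real.exp (-(∑ i, ξ' i * y i)) : ℂ) * φ ξ') ξ) :
    (∀ y ∈ insert (0 : Fin n → ℝ) C',
      Integrable (fun ξ : Fin n → ℝ => (Real.exp (k * n1 ξ) : ℂ) * g ξ *
        Dm γ (fun ξ' => (Real.exp (-(∑ i, ξ' i * y i)) : ℂ) * φ ξ') ξ)) ∧
    Filter.Tendsto G (nhdsWithin 0 C')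
      (nhds ((-1 : ℂ) ^ mOrd γ *
        ∫ ξ : Fin n → ℝ, (Real.exp (k * n1 ξ) : ℂ) * g ξ * Dm γ φ ξ)) := by
  have hp := hψ.rapidDecay
  set c : ℂ := (((2 * Real.pi) ^ n : ℝ) : ℂ)⁻¹ with hc
  set P : (Fin n → ℝ) → (Fin n → ℝ) → ℂ := fun y x =>
    (∏ i, rotCoord y x i ^ γ i) * ψ (fun i => (x i : ℂ)) with hP
  have hE : ∀ y : Fin n → ℝ, (fun ξ' => (Real.exp (-(∑ i, ξ' i * y i)) : ℂ) * φ ξ') =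
      fun ξ => c * laplaceInt y (fun x => ψ (fun i => (x i : ℂ))) ξ := by
    intro y
    ext ξ
    rw [hφ, laplaceInt, mul_left_comm, ← integral_const_mul]
    congr 2
    ext x
    rw [mul_left_comm, ofReal_exp, ← Complex.exp_add, expPair]
    congr 2
    push_cast
    rw [Finset.mul_sum, ← Finset.sum_neg_distrib, ← Finset.sum_add_distrib]
    refine Finset.sum_congr rfl fun j _ => ?_
    rw [rotCoord]
    linear_combination -(ξ j * y j : ℂ) * I_mul_I
  have hD : ∀ y, Dm γ (fun ξ' => (Real.exp (-(∑ i, ξ' i * y i)) : ℂ) * φ ξ') =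
      fun ξ => c * laplaceInt y (P y) ξ := fun y => by rw [hE, hp.Dm_laplaceInt]
  have hD0 : Dm γ φ = fun ξ => c * laplaceInt 0 (P 0) ξ := by simpa using hD 0
  obtain ⟨M, hM⟩ := hgb
  have hpos : ∀ ξ, g ξ ≠ 0 → ∀ y ∈ insert (0 : Fin n → ℝ) C', 0 ≤ ∑ i, ξ i * y i := by
    rintro ξ hξ y (rfl | hy)
    · simp
    · have h0 : 0 ≤ en ξ * en y := mul_nonneg (Real.sqrt_nonneg _) (Real.sqrt_nonneg _)
      exact (mul_nonneg hδ.le h0).trans (hsep ξ (hsupp hξ) y hy)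
  have hdom : ∀ R : ℝ, ∃ K : ℝ, ∀ y ∈ insert (0 : Fin n → ℝ) C', ‖y‖ ≤ R → ∀ ξ,
      ‖(Real.exp (k * n1 ξ) : ℂ) * g ξ * (c * laplaceInt y (P y) ξ)‖ ≤
        K * Real.exp (-n1 ξ) := by
    intro R
    obtain ⟨K, hK⟩ := hψ.norm_laplaceInt_le γ (by linarith : 0 ≤ k + 1) R
    refine ⟨M * ‖c‖ * |K|, fun y hyC hy ξ => ?_⟩
    have hM0 : 0 ≤ M := (norm_nonneg _).trans (hM ξ)
    by_cases hg : g ξ = 0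
    · simp only [hg, mul_zero, zero_mul, norm_zero]; positivity
    have h1 : ‖laplaceInt y (P y) ξ‖ ≤ |K| * Real.exp (-((k + 1) * n1 ξ)) := by
      refine (hK y hy ξ).trans ?_
      have he : Real.exp (-∑ j, ξ j * y j) ≤ 1 :=
        Real.exp_le_one_iff.2 (neg_nonpos.2 (hpos ξ hg y hyC))
      calc _ ≤ Real.exp (-∑ j, ξ j * y j) * (|K| * Real.exp (-((k + 1) * n1 ξ))) := by
            gcongr; exact le_abs_self K
        _ ≤ _ := mul_le_of_le_one_left (by positivity) he
    have h2 : ‖(Real.exp (k * n1 ξ) : ℂ)‖ = Real.exp (k * n1 ξ) := by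
      rw [norm_real, Real.norm_of_nonneg (Real.exp_pos _).le]
    rw [norm_mul, norm_mul, norm_mul, h2]
    calc _ ≤ Real.exp (k * n1 ξ) * M * (‖c‖ * (|K| * Real.exp (-((k + 1) * n1 ξ)))) := by
          gcongr; exact hM ξ
      _ = M * ‖c‖ * |K| * (Real.exp (k * n1 ξ) * Real.exp (-((k + 1) * n1 ξ))) := by ring
      _ = _ := by rw [← Real.exp_add]; congr 2; ring
  have hcont : ∀ y, Continuous fun ξ =>
      (Real.exp (k * n1 ξ) : ℂ) * g ξ * (c * laplaceInt y (P y) ξ) := by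
    intro y
    have h1 := (hp.prod_rotCoord_mul y γ).continuous_laplaceInt y
    have h2 := continuous_n1 (n := n)
    fun_prop
  constructor
  · intro y hy
    obtain ⟨K, hK⟩ := hdom ‖y‖
    rw [hD]
    exact (integrable_exp_neg_n1.const_mul K).mono' (hcont y).aestronglyMeasurable
      (Eventually.of_forall (hK y hy le_rfl))
  · obtain ⟨K, hK⟩ := hdom 1
    simp only [hG, hD, hD0]
    refine Tendsto.const_mul _ (tendsto_integral_filter_of_dominated_convergence
      (fun ξ => K * Real.exp (-n1 ξ))
      (Eventually.of_forall fun y => (hcont y).aestronglyMeasurable) ?_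
      (integrable_exp_neg_n1.const_mul K) (Eventually.of_forall fun ξ => ?_))
    · filter_upwards [self_mem_nhdsWithin, mem_nhdsWithin_of_mem_nhds
        (Metric.closedBall_mem_nhds (0 : Fin n → ℝ) one_pos)] with y hyC hy
      exact Eventually.of_forall (hK y (Set.mem_insert_of_mem _ hyC) (by simpa using hy))
    · exact (((hψ.tendsto_laplaceInt γ ξ).mono_left nhdsWithin_le_nhds).const_mul c).const_mul _
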